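/- arXiv:1902.02319 — 3 statements merged into one kernel-verified Lean document; each statement's English description precedes it below -/
import Mathlib

section
/- There exists an absolute constant C₀ > 0 with the following property: for every arc J ⊆ 𝕋 with arclength |J| ≤ 1/8, all reals L, M > 0 with L·|J| > 1 and M·|J| > 1, every b ∈ L¹(𝕋) supported in J, and every x ∈ 𝕋 ∖ (2J), one has |(b ∗ φ_L ∗ φ_M)(x)| ≤ C₀ ‖b‖_{L¹(𝕋)} |J|^{-1} [M_c(χ_J)(x)]^{3/2}. -/
open MeasureTheory Real
open scoped ENNReal

noncomputable section

instance : Fact (0 < 2 * π) := ⟨by positivity⟩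

/-- The torus `ℝ/(2πℤ)`. -/
abbrev Tor := AddCircle (2 * π)

/-- The normalized Haar measure `(2π)⁻¹ dx` on the torus. -/
def haarT : Measure Tor := AddCircle.haarAddCircle

/-- Normalized convolution on the torus: `(f ∗ g)(x) = (2π)⁻¹ ∫ f(y) g(x-y) dy`. -/
def convT (f g : Tor → ℝ) (x : Tor) : ℝ := ∫ y, f y * g (x - y) ∂haarT

/-- The kernel `φ_L(x) = L (1 + L² sin²(x/2))^{-3/4}` on the torus. -/
def phi (L : ℝ) : Tor → ℝ :=
  Function.Periodic.lift (c := 2 * π)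
    (f := fun x : ℝ => L * (1 + L ^ 2 * Real.sin (x / 2) ^ 2) ^ (-(3:ℝ)/4))
    (by
      intro x
      simp only []
      have h : (x + 2 * π) / 2 = x / 2 + π := by ring
      rw [h, Real.sin_add_pi]
      ring_nf)

/-- The (open) arc of the torus with centre `c : ℝ` and arclength `ℓ`. -/
def arc (c ℓ : ℝ) : Set Tor := (fun t : ℝ => (t : Tor)) '' Set.Ioo (c - ℓ / 2) (c + ℓ / 2)

/-- The centred Hardy–Littlewood maximal operator on the torus:
`M_c g (x) = sup_{0<r≤π} r⁻¹ ∫_{|t|<r} |g(x-t)| dt`. -/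
def Mc (g : Tor → ℝ) (x : Tor) : ℝ :=
  ⨆ r : Set.Ioc (0:ℝ) π, (r : ℝ)⁻¹ * ∫ t in Set.Ioo (-(r:ℝ)) (r:ℝ), |g (x - (t : Tor))|

instance : haarT.IsAddHaarMeasure := by unfold haarT; infer_instance

lemma phi_coe (L t : ℝ) :
    phi L (t : Tor) = L * (1 + L ^ 2 * Real.sin (t / 2) ^ 2) ^ (-(3:ℝ)/4) := rfl

lemma phi_nonneg {L : ℝ} (hL : 0 < L) (u : Tor) : 0 ≤ phi L u := by
  obtain ⟨t, rfl⟩ := QuotientAddGroup.mk_surjective u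
  rw [phi_coe]
  positivity

lemma continuous_phi (L : ℝ) : Continuous (phi L) := by
  refine continuous_quot_lift _ (Continuous.mul continuous_const ?_)
  refine Continuous.rpow_const (by fun_prop) fun x => Or.inl ?_
  positivity

/-- Every point of the torus is represented by a real number of absolute value its norm. -/
lemma Tor.exists_coe_eq (u : Tor) : ∃ s : ℝ, (s : Tor) = u ∧ |s| = ‖u‖ ∧ |s| ≤ π := by
  obtain ⟨t, ht, htu⟩ := AddCircle.eq_coe_Ico (p := 2 * π) (u + ((π : ℝ) : Tor))
  obtain ⟨s, hs, rfl⟩ : ∃ s : ℝ, (-π ≤ s ∧ s ≤ π) ∧ (s : Tor) = u :=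
    ⟨t - π, ⟨by linarith [ht.1], by linarith [ht.2]⟩, by
      rw [AddCircle.coe_sub, htu, add_sub_cancel_right]⟩
  have hs' : |s| ≤ π := abs_le.2 hs
  have hpi := Real.pi_pos
  refine ⟨s, rfl, ?_, hs'⟩
  refine ((AddCircle.norm_coe_eq_abs_iff (2 * π) (by positivity)).2 ?_).symm
  rw [abs_of_pos (a := 2 * π) (by positivity)]
  linarith

lemma Tor.norm_coe_le_abs (t : ℝ) : ‖(t : Tor)‖ ≤ |t| := by
  simpa using QuotientAddGroup.norm_mk_le_norm (S := AddSubgroup.zmultiples (2 * π)) (m := t)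

lemma sq_div_pi_le_sin_half_sq {t : ℝ} (ht : |t| ≤ π) : (t / π) ^ 2 ≤ Real.sin (t / 2) ^ 2 := by
  have h : |t / 2| ≤ π / 2 := by rw [abs_div, abs_two]; linarith
  have := Real.mul_abs_le_abs_sin h
  rw [sq_le_sq]
  refine le_trans (le_of_eq ?_) this
  rw [abs_div, abs_div, abs_two, abs_of_pos Real.pi_pos]
  ring

lemma phi_coe_le {L t : ℝ} (hL : 0 < L) (ht : |t| ≤ π) :
    phi L (t : Tor) ≤ L * (1 + ‖L / π * t‖ ^ 2) ^ (-(3 / 2 : ℝ) / 2) := by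
  rw [phi_coe]
  have h := sq_div_pi_le_sin_half_sq ht
  have e : (-(3 / 2 : ℝ) / 2) = -(3:ℝ) / 4 := by norm_num
  rw [e]
  refine mul_le_mul_of_nonneg_left ?_ hL.le
  refine Real.rpow_le_rpow_of_nonpos (by positivity) ?_ (by norm_num)
  have : ‖L / π * t‖ ^ 2 = L ^ 2 * (t / π) ^ 2 := by
    rw [Real.norm_eq_abs, sq_abs]; ring
  rw [this]
  gcongr

/-- An absolute bound for the `L¹` norms of the kernels `phi L`. -/
def phiMass : ℝ := ∫ t : ℝ, (1 + ‖t‖ ^ 2) ^ (-(3 / 2 : ℝ) / 2)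

lemma phiMass_nonneg : 0 ≤ phiMass := integral_nonneg fun t => by positivity

lemma integral_phi_le {L : ℝ} (hL : 0 < L) : ∫ u, phi L u ∂haarT ≤ phiMass := by
  have hpi := Real.pi_pos
  have hint : Integrable fun t : ℝ => (1 + ‖t‖ ^ 2) ^ (-(3 / 2 : ℝ) / 2) :=
    integrable_rpow_neg_one_add_norm_sq (by simp; norm_num)
  have hint' : Integrable fun t : ℝ => L * (1 + ‖L / π * t‖ ^ 2) ^ (-(3 / 2 : ℝ) / 2) :=
    (hint.comp_mul_left' (R := L / π) (by positivity)).const_mul L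
  have h1 : ∫ u, phi L u ∂haarT =
      (2 * π)⁻¹ * ∫ t in Set.Ioc (-π) (-π + 2 * π), phi L (t : Tor) := by
    rw [AddCircle.integral_preimage (2 * π) (-π) (phi L)]
    exact AddCircle.integral_haarAddCircle
  have h2 : ∫ t in Set.Ioc (-π) (-π + 2 * π), phi L (t : Tor) ≤
      ∫ t in Set.Ioc (-π) (-π + 2 * π), L * (1 + ‖L / π * t‖ ^ 2) ^ (-(3 / 2 : ℝ) / 2) := by
    refine setIntegral_mono_on ?_ hint'.integrableOn measurableSet_Ioc fun t ht => ?_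
    · refine (Continuous.integrableOn_Icc ?_).mono_set Set.Ioc_subset_Icc_self
      exact (continuous_phi L).comp (AddCircle.continuous_mk' _)
    · exact phi_coe_le hL (abs_le.2 ⟨ht.1.le, by linarith [ht.2]⟩)
  have h3 : ∫ t in Set.Ioc (-π) (-π + 2 * π), L * (1 + ‖L / π * t‖ ^ 2) ^ (-(3 / 2 : ℝ) / 2) ≤
      ∫ t, L * (1 + ‖L / π * t‖ ^ 2) ^ (-(3 / 2 : ℝ) / 2) :=
    setIntegral_le_integral hint' (Filter.Eventually.of_forall fun t => by positivity)
  have h4 : ∫ t, L * (1 + ‖L / π * t‖ ^ 2) ^ (-(3 / 2 : ℝ) / 2) = π * phiMass := by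
    rw [integral_const_mul,
      Measure.integral_comp_mul_left (fun t : ℝ => (1 + ‖t‖ ^ 2) ^ (-(3 / 2 : ℝ) / 2)) (L / π),
      abs_of_pos (by positivity), smul_eq_mul, phiMass]
    field_simp
  rw [h1]
  have h5 := phiMass_nonneg
  calc _ ≤ (2 * π)⁻¹ * (π * phiMass) := by
        rw [← h4]; exact mul_le_mul_of_nonneg_left (h2.trans h3) (by positivity)
    _ = phiMass / 2 := by field_simp
    _ ≤ phiMass := by linarith

lemma lintegral_phi_le {L : ℝ} (hL : 0 < L) :
    ∫⁻ u, ENNReal.ofReal (phi L u) ∂haarT ≤ ENNReal.ofReal phiMass := by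
  rw [← ofReal_integral_eq_lintegral_ofReal _ (Filter.Eventually.of_forall (phi_nonneg hL))]
  · exact ENNReal.ofReal_le_ofReal (integral_phi_le hL)
  · exact (continuous_phi L).integrable_of_hasCompactSupport
      (HasCompactSupport.of_compactSpace _)

lemma phi_le_of_le_norm {L ℓ D : ℝ} (hL : 0 < L) (hℓ : 0 < ℓ) (hLℓ : 1 < L * ℓ) (hD : 0 < D)
    {u : Tor} (hu : D ≤ ‖u‖) : phi L u ≤ ℓ⁻¹ * (π * (ℓ / D)) ^ (3 / 2 : ℝ) := by
  obtain ⟨t, rfl, ht, htpi⟩ := Tor.exists_coe_eq u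
  have hpi := Real.pi_pos
  rw [← ht] at hu
  refine (phi_coe_le hL htpi).trans ?_
  have h1 : (1 + ‖L / π * t‖ ^ 2) ^ (-(3 / 2 : ℝ) / 2) ≤ ((L / π * D) ^ 2) ^ (-(3 / 2 : ℝ) / 2) := by
    refine Real.rpow_le_rpow_of_nonpos (by positivity) ?_ (by norm_num)
    have : L / π * D ≤ ‖L / π * t‖ := by
      rw [norm_mul, Real.norm_of_nonneg (by positivity), Real.norm_eq_abs]
      gcongr
    have := pow_le_pow_left₀ (by positivity) this 2
    linarith
  have h2 : ((L / π * D) ^ 2) ^ (-(3 / 2 : ℝ) / 2) =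
      (L * ℓ) ^ (-(3 / 2) : ℝ) * (π * (ℓ / D)) ^ (3 / 2 : ℝ) := by
    rw [← Real.rpow_natCast, ← Real.rpow_mul (by positivity),
      show L / π * D = (L * ℓ) * (π * (ℓ / D))⁻¹ by field_simp,
      Real.mul_rpow (by positivity) (by positivity), Real.inv_rpow (by positivity),
      ← Real.rpow_neg (by positivity)]
    norm_num
  have h3 : L * (L * ℓ) ^ (-(3 / 2) : ℝ) ≤ ℓ⁻¹ := by
    have : (L * ℓ) ^ (-(3 / 2) : ℝ) ≤ (L * ℓ) ^ (-1 : ℝ) :=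
      Real.rpow_le_rpow_of_exponent_le hLℓ.le (by norm_num)
    rw [Real.rpow_neg_one] at this
    calc _ ≤ L * (L * ℓ)⁻¹ := mul_le_mul_of_nonneg_left this hL.le
      _ = ℓ⁻¹ := by field_simp
  calc _ ≤ L * ((L * ℓ) ^ (-(3 / 2) : ℝ) * (π * (ℓ / D)) ^ (3 / 2 : ℝ)) := by
        rw [← h2]; exact mul_le_mul_of_nonneg_left h1 hL.le
    _ = (L * (L * ℓ) ^ (-(3 / 2) : ℝ)) * (π * (ℓ / D)) ^ (3 / 2 : ℝ) := by ring
    _ ≤ _ := mul_le_mul_of_nonneg_right h3 (by positivity)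

lemma arc_eq_ball (c ℓ : ℝ) : arc c ℓ = Metric.ball (c : Tor) (ℓ / 2) := by
  ext x
  rw [mem_ball_iff_norm]
  constructor
  · rintro ⟨t, ht, rfl⟩
    change ‖(t : Tor) - (c : Tor)‖ < _
    rw [← AddCircle.coe_sub]
    refine (Tor.norm_coe_le_abs _).trans_lt (abs_lt.2 ⟨?_, ?_⟩) <;> linarith [ht.1, ht.2]
  · intro h
    obtain ⟨s, hs, hsn, -⟩ := Tor.exists_coe_eq (x - c)
    rw [← hsn, abs_lt] at h
    refine ⟨c + s, ⟨by linarith [h.1], by linarith [h.2]⟩, ?_⟩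
    change ((c + s : ℝ) : Tor) = x
    rw [AddCircle.coe_add, hs, add_sub_cancel]

lemma div_le_Mc_indicator_arc {c ℓ : ℝ} (hℓ : 0 < ℓ) {x : Tor} (hx : ℓ ≤ ‖x - c‖) :
    ℓ / (2 * ‖x - c‖) ≤ Mc ((arc c ℓ).indicator fun _ => (1:ℝ)) x := by
  obtain ⟨s, hs, hsn, hspi⟩ := Tor.exists_coe_eq (x - c)
  rw [← hsn] at hx ⊢
  set f : Tor → ℝ := (arc c ℓ).indicator fun _ => (1:ℝ) with hf
  have hf0 : ∀ u, 0 ≤ f u := fun u => Set.indicator_nonneg (fun _ _ => zero_le_one) u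
  have hf1 : ∀ u, f u ≤ 1 := fun u => Set.indicator_le_self' (fun _ _ => zero_le_one) u
  have hfm : Measurable fun t : ℝ => |f (x - (t : Tor))| := by
    have : Measurable f := by
      rw [hf, arc_eq_ball]
      exact measurable_const.indicator measurableSet_ball
    have h2 : Measurable fun t : ℝ => x - (t : Tor) :=
      (continuous_const.sub (AddCircle.continuous_mk' _)).measurable
    exact (this.comp h2).abs
  have hfi : ∀ r : ℝ, IntegrableOn (fun t : ℝ => |f (x - (t : Tor))|) (Set.Ioo (-r) r) := by
    intro r
    refine Measure.integrableOn_of_bounded (M := 1) (by simp) hfm.aestronglyMeasurable ?_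
    refine Filter.Eventually.of_forall fun t => ?_
    rw [Real.norm_eq_abs, abs_abs, abs_of_nonneg (hf0 _)]
    exact hf1 _
  have hbdd : BddAbove (Set.range fun r : Set.Ioc (0:ℝ) π =>
      (r : ℝ)⁻¹ * ∫ t in Set.Ioo (-(r:ℝ)) (r:ℝ), |f (x - (t : Tor))|) := by
    refine ⟨2, ?_⟩
    rintro _ ⟨⟨r, hr0, hr⟩, rfl⟩
    have : ∫ t in Set.Ioo (-r) r, |f (x - (t : Tor))| ≤ ∫ t in Set.Ioo (-r) r, (1:ℝ) := by
      refine setIntegral_mono (hfi r) (by simp) fun t => ?_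
      change |f _| ≤ 1
      rw [abs_of_nonneg (hf0 _)]
      exact hf1 _
    have h2 : ∫ t in Set.Ioo (-r) r, (1:ℝ) = 2 * r := by
      simp only [setIntegral_const, smul_eq_mul, mul_one, Measure.real, Real.volume_Ioo]
      rw [ENNReal.toReal_ofReal (by linarith)]; ring
    change r⁻¹ * _ ≤ 2
    rw [h2] at this
    calc _ ≤ r⁻¹ * (2 * r) := mul_le_mul_of_nonneg_left this (by positivity)
      _ = 2 := by field_simp
  have hs0 : 0 < |s| := hℓ.trans_le hx
  refine le_trans ?_ (le_ciSup hbdd ⟨|s|, hs0, hspi⟩)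
  change _ ≤ |s|⁻¹ * ∫ t in Set.Ioo (-|s|) |s|, |f (x - (t : Tor))|
  have key : ∃ a : ℝ, Set.Ioo a (a + ℓ / 2) ⊆ Set.Ioo (-|s|) |s| ∧
      Set.Ioo a (a + ℓ / 2) ⊆ Set.Ioo (s - ℓ / 2) (s + ℓ / 2) := by
    rcases le_total 0 s with h | h
    · rw [abs_of_nonneg h] at hx ⊢
      refine ⟨s - ℓ / 2, Set.Ioo_subset_Ioo ?_ ?_, Set.Ioo_subset_Ioo ?_ ?_⟩ <;> linarith
    · rw [abs_of_nonpos h] at hx ⊢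
      refine ⟨s, Set.Ioo_subset_Ioo ?_ ?_, Set.Ioo_subset_Ioo ?_ ?_⟩ <;> linarith
  obtain ⟨a, ha1, ha2⟩ := key
  have hlow : ℓ / 2 ≤ ∫ t in Set.Ioo (-|s|) |s|, |f (x - (t : Tor))| := by
    calc ℓ / 2 = ∫ t in Set.Ioo a (a + ℓ / 2), (1:ℝ) := by
          simp only [setIntegral_const, smul_eq_mul, mul_one, Measure.real, Real.volume_Ioo]
          rw [ENNReal.toReal_ofReal (by linarith)]; ring
      _ = ∫ t in Set.Ioo a (a + ℓ / 2), |f (x - (t : Tor))| := by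
          refine setIntegral_congr_fun measurableSet_Ioo fun t ht => ?_
          have hmem : x - (t : Tor) ∈ arc c ℓ := by
            have ht' := ha2 ht
            refine ⟨c + s - t, ⟨by linarith [ht'.2], by linarith [ht'.1]⟩, ?_⟩
            change ((c + s - t : ℝ) : Tor) = _
            rw [AddCircle.coe_sub, AddCircle.coe_add, hs, add_sub_cancel]
          simp [hf, Set.indicator_of_mem hmem]
      _ ≤ _ := setIntegral_mono_set (hfi _) (Filter.Eventually.of_forall fun t => abs_nonneg _)
          ha1.eventuallyLE
  calc ℓ / (2 * |s|) = |s|⁻¹ * (ℓ / 2) := by field_simp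
    _ ≤ _ := mul_le_mul_of_nonneg_left hlow (by positivity)

lemma enorm_convT_convT_phi_le {L M : ℝ} (hL : 0 < L) (hM : 0 < M) {b : Tor → ℝ}
    (hb : Integrable b haarT) (x : Tor) :
    ‖convT (convT b (phi L)) (phi M) x‖ₑ ≤ ∫⁻ y, ‖b y‖ₑ *
      ∫⁻ z, ENNReal.ofReal (phi L (z - y)) * ENNReal.ofReal (phi M (x - z)) ∂haarT ∂haarT := by
  have hmL : Measurable fun p : Tor × Tor => ENNReal.ofReal (phi L (p.1 - p.2)) :=
    (ENNReal.continuous_ofReal.comp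
      ((continuous_phi L).comp (continuous_fst.sub continuous_snd))).measurable
  have hmM : Measurable fun z : Tor => ENNReal.ofReal (phi M (x - z)) :=
    (ENNReal.continuous_ofReal.comp
      ((continuous_phi M).comp (continuous_const.sub continuous_id))).measurable
  calc ‖convT (convT b (phi L)) (phi M) x‖ₑ
      ≤ ∫⁻ z, ‖convT b (phi L) z * phi M (x - z)‖ₑ ∂haarT := enorm_integral_le_lintegral_enorm _
    _ ≤ ∫⁻ z, ∫⁻ y, ‖b y‖ₑ *
          (ENNReal.ofReal (phi L (z - y)) * ENNReal.ofReal (phi M (x - z))) ∂haarT ∂haarT := by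
        refine lintegral_mono fun z => ?_
        rw [enorm_mul, Real.enorm_of_nonneg (phi_nonneg hM _)]
        simp_rw [← mul_assoc]
        rw [lintegral_mul_const' _ _ ENNReal.ofReal_ne_top]
        gcongr
        refine (enorm_integral_le_lintegral_enorm _).trans (le_of_eq ?_)
        refine lintegral_congr fun y => ?_
        rw [enorm_mul, Real.enorm_of_nonneg (phi_nonneg hL _)]
    _ = ∫⁻ y, ∫⁻ z, ‖b y‖ₑ *
          (ENNReal.ofReal (phi L (z - y)) * ENNReal.ofReal (phi M (x - z))) ∂haarT ∂haarT := by
        refine lintegral_lintegral_swap ?_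
        exact (hb.1.comp_snd.enorm).mul (hmL.mul (hmM.comp measurable_fst)).aemeasurable
    _ = _ := by
        refine lintegral_congr fun y => ?_
        rw [lintegral_const_mul' _ _ enorm_ne_top]

lemma lintegral_phi_mul_phi_le {L M Q : ℝ} (hL : 0 < L) (hM : 0 < M) (hQ : 0 ≤ Q) {x y : Tor}
    (h : ∀ z, phi L (z - y) ≤ Q ∨ phi M (x - z) ≤ Q) :
    ∫⁻ z, ENNReal.ofReal (phi L (z - y)) * ENNReal.ofReal (phi M (x - z)) ∂haarT ≤
      ENNReal.ofReal (2 * phiMass * Q) := by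
  have hmL : Measurable fun z : Tor => ENNReal.ofReal (phi L (z - y)) :=
    (ENNReal.continuous_ofReal.comp
      ((continuous_phi L).comp (continuous_id.sub continuous_const))).measurable
  calc _ ≤ ∫⁻ z, ENNReal.ofReal Q * (ENNReal.ofReal (phi L (z - y)) +
          ENNReal.ofReal (phi M (x - z))) ∂haarT := by
        refine lintegral_mono fun z => ?_
        change _ * _ ≤ _ * (_ + _)
        rw [mul_add]
        rcases h z with h | h
        · exact (mul_le_mul_left (ENNReal.ofReal_le_ofReal h) _).trans le_add_self
        · rw [mul_comm]
          exact (mul_le_mul_left (ENNReal.ofReal_le_ofReal h) _).trans le_self_add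
    _ = ENNReal.ofReal Q * (∫⁻ z, ENNReal.ofReal (phi L z) ∂haarT +
          ∫⁻ z, ENNReal.ofReal (phi M z) ∂haarT) := by
        rw [lintegral_const_mul' _ _ ENNReal.ofReal_ne_top, lintegral_add_left hmL,
          lintegral_sub_right_eq_self (fun z => ENNReal.ofReal (phi L z)) y,
          lintegral_sub_left_eq_self (fun z => ENNReal.ofReal (phi M z)) x]
    _ ≤ ENNReal.ofReal Q * (ENNReal.ofReal phiMass + ENNReal.ofReal phiMass) := by
        gcongr
        · exact lintegral_phi_le hL
        · exact lintegral_phi_le hM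
    _ = _ := by
        rw [← ENNReal.ofReal_add phiMass_nonneg phiMass_nonneg, ← ENNReal.ofReal_mul hQ]
        congr 1; ring

/-- There is an absolute constant `C₀ > 0` such that for every arc `J` with `|J| ≤ 1/8`,
all `L, M > 0` with `L·|J| > 1` and `M·|J| > 1`, every `b ∈ L¹(𝕋)` supported in `J`, and
every `x ∉ 2J`, one has `|(b ∗ φ_L ∗ φ_M)(x)| ≤ C₀ ‖b‖_{L¹} |J|⁻¹ (M_c χ_J (x))^{3/2}`. -/
theorem statement11 :
    ∃ C₀ : ℝ, 0 < C₀ ∧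
      ∀ (c ℓ : ℝ), 0 < ℓ → ℓ ≤ 1 / 8 →
      ∀ L M : ℝ, 0 < L → 0 < M → 1 < L * ℓ → 1 < M * ℓ →
      ∀ b : Tor → ℝ, Integrable b haarT →
        (∀ x : Tor, x ∉ arc c ℓ → b x = 0) →
        ∀ x : Tor, x ∉ arc c (2 * ℓ) →
          |convT (convT b (phi L)) (phi M) x| ≤
            C₀ * (∫ y, |b y| ∂haarT) * ℓ⁻¹ *
              (Mc ((arc c ℓ).indicator fun _ => (1:ℝ)) x) ^ ((3:ℝ)/2) := by
  have hpi := Real.pi_pos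
  have hmass := phiMass_nonneg
  refine ⟨(2 * phiMass + 1) * (8 * π) ^ ((3:ℝ)/2), by positivity, ?_⟩
  intro c ℓ hℓ _ L M hL hM hLℓ hMℓ b hb hsupp x hx
  have hD : ℓ ≤ ‖x - c‖ := by
    rw [arc_eq_ball, mem_ball_iff_norm, not_lt] at hx
    linarith
  have hmax := div_le_Mc_indicator_arc hℓ hD
  set D := ‖x - c‖
  set m := Mc ((arc c ℓ).indicator fun _ => (1:ℝ)) x
  have hD0 : 0 < D := hℓ.trans_le hD
  have hm0 : 0 ≤ m := le_trans (by positivity) hmax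
  set Q := ℓ⁻¹ * ((8 * π) ^ ((3:ℝ)/2) * m ^ ((3:ℝ)/2)) with hQdef
  have hQ : 0 ≤ Q := by positivity
  have hphi : ∀ {K : ℝ}, 0 < K → 1 < K * ℓ → ∀ {u : Tor}, D / 4 ≤ ‖u‖ → phi K u ≤ Q := by
    intro K hK hKℓ u hu
    refine (phi_le_of_le_norm hK hℓ hKℓ (by positivity) hu).trans ?_
    rw [hQdef, ← Real.mul_rpow (by positivity) hm0]
    refine mul_le_mul_of_nonneg_left (Real.rpow_le_rpow (by positivity) ?_ (by norm_num))
      (by positivity)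
    calc π * (ℓ / (D / 4)) = 8 * π * (ℓ / (2 * D)) := by field_simp; norm_num
      _ ≤ 8 * π * m := by gcongr
  have hpt : ∀ y, ‖b y‖ₑ * ∫⁻ z, ENNReal.ofReal (phi L (z - y)) *
      ENNReal.ofReal (phi M (x - z)) ∂haarT ≤ ‖b y‖ₑ * ENNReal.ofReal (2 * phiMass * Q) := by
    intro y
    by_cases hy : y ∈ arc c ℓ
    · refine mul_le_mul_right (lintegral_phi_mul_phi_le hL hM hQ fun z => ?_) _
      rw [arc_eq_ball, mem_ball_iff_norm] at hy
      have htri : D ≤ ‖x - z‖ + ‖z - y‖ + ‖y - c‖ := by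
        have e : x - c = (x - z) + (z - y) + (y - c) := by abel
        change ‖x - c‖ ≤ _
        rw [e]
        exact norm_add₃_le
      rcases le_total (D / 4) ‖z - y‖ with h | h
      · exact Or.inl (hphi hL hLℓ h)
      · exact Or.inr (hphi hM hMℓ (by linarith))
    · simp [hsupp y hy]
  have hmain : ‖convT (convT b (phi L)) (phi M) x‖ₑ ≤
      ENNReal.ofReal ((∫ y, |b y| ∂haarT) * (2 * phiMass * Q)) := by
    refine (enorm_convT_convT_phi_le hL hM hb x).trans ((lintegral_mono hpt).trans ?_)
    rw [lintegral_mul_const' _ _ ENNReal.ofReal_ne_top,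
      ENNReal.ofReal_mul (integral_nonneg fun _ => abs_nonneg _)]
    exact (congrArg (· * _) (ofReal_integral_norm_eq_lintegral_enorm hb).symm).le
  have hI : 0 ≤ ∫ y, |b y| ∂haarT := integral_nonneg fun _ => abs_nonneg _
  rw [← ofReal_norm, ENNReal.ofReal_le_ofReal_iff (by positivity)] at hmain
  calc _ ≤ (∫ y, |b y| ∂haarT) * (2 * phiMass * Q) := hmain
    _ ≤ (∫ y, |b y| ∂haarT) * ((2 * phiMass + 1) * Q) := by gcongr; linarith
    _ = _ := by rw [hQdef]; ring

end
end

section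
/- Let s be a Schwartz function on ℝ with supp(s) ⊆ [−1,1] and s(0) = 1, and let ŝ(ξ) := (2π)^{-1}∫_ℝ s(x)e^{-ixξ}dx. Then there exists a constant C > 0, depending only on s, with the following property. Let a < b be integers and t ∈ (0, 1/8] a real with (b−a)·t > 1; set N := ⌊t^{-1}⌋, L := {a, a+1, …, a+N}, L' := {b−1−N, …, b−1}, and define for n ∈ ℤ: P(n) := max(0, 1 − |n−a|/(N+1)), P̃(n) := max(0, 1 − |n−(b−1)|/(N+1)), Q(n) := χ_{{a,…,b−1}}(n)·[1 − P(n) − P̃(n)], and R(n) := Q(n) − Σ_{l∈ℤ} Q(l)·t·ŝ(t(n−l)). Then for every n ∈ ℤ: |R(n)| ≤ C([M_d(χ_L)(n)]² + [M_d(χ_{L'})(n)]²) and |R(n+1) − R(n)| ≤ C·t·([M_d(χ_L)(n)]² + [M_d(χ_{L'})(n)]²). -/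
open scoped BigOperators

noncomputable section

/-- The centred discrete Hardy–Littlewood maximal operator:
`M_d a (n) = sup_{N ≥ 1} N⁻¹ Σ_{|k|<N} |a(n-k)|`. -/
def Md (a : ℤ → ℝ) (n : ℤ) : ℝ :=
  ⨆ N : ℕ+, ((N : ℕ) : ℝ)⁻¹ * ∑ k ∈ Finset.Ioo (-((N : ℕ) : ℤ)) ((N : ℕ) : ℤ), |a (n - k)|

/-- `ŝ(ξ) = (2π)⁻¹ ∫ s(x) e^{-ixξ} dx`. -/
def hatS (s : ℝ → ℝ) (ξ : ℝ) : ℂ :=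
  (2 * Real.pi)⁻¹ • ∫ x : ℝ, (s x : ℂ) * Complex.exp (-(Complex.I * (x * ξ)))

/-- The triangular bump `P(n) = max(0, 1 - |n - a|/(N+1))`. -/
def Pfun (a : ℤ) (N : ℕ) (n : ℤ) : ℝ := max 0 (1 - |((n - a : ℤ) : ℝ)| / (N + 1))

/-- `Q(n) = χ_{{a,…,b-1}}(n)·[1 - P(n) - P̃(n)]`. -/
def Qfun (a b : ℤ) (N : ℕ) (n : ℤ) : ℝ :=
  if a ≤ n ∧ n < b then 1 - Pfun a N n - Pfun (b - 1) N n else 0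

/-- `R(n) = Q(n) - Σ_{l∈ℤ} Q(l)·t·ŝ(t(n-l))`, where `N = ⌊t⁻¹⌋`. -/
def Rfun (s : ℝ → ℝ) (a b : ℤ) (t : ℝ) (n : ℤ) : ℂ :=
  ((Qfun a b (Nat.floor t⁻¹) n : ℝ) : ℂ) -
    ∑' l : ℤ, ((Qfun a b (Nat.floor t⁻¹) l : ℝ) : ℂ) *
      ((t : ℂ) * hatS s (t * ((n : ℝ) - (l : ℝ))))

open scoped SchwartzMap FourierTransform in
/-- Dilation `x ↦ f (c x)` of a Schwartz function. -/
def dilate (c : ℝ) (hc : c ≠ 0) (f : 𝓢(ℝ, ℂ)) : 𝓢(ℝ, ℂ) :=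
  SchwartzMap.compCLMOfContinuousLinearEquiv ℂ
    (ContinuousLinearEquiv.smulLeft (R₁ := ℝ) (M₁ := ℝ) (Units.mk0 c hc)) f

open scoped SchwartzMap FourierTransform in
lemma dilate_apply (c : ℝ) (hc : c ≠ 0) (f : 𝓢(ℝ, ℂ)) (x : ℝ) :
    dilate c hc f x = f (c * x) := rfl

open scoped SchwartzMap FourierTransform in
lemma fourier_dilate (c : ℝ) (hc : 0 < c) (f : 𝓢(ℝ, ℂ)) (ξ : ℝ) :
    𝓕 (dilate c hc.ne' f) ξ = (c⁻¹ : ℝ) • 𝓕 f (c⁻¹ * ξ) := by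
  rw [SchwartzMap.fourier_coe, SchwartzMap.fourier_coe, Real.fourier_real_eq_integral_exp_smul,
    Real.fourier_real_eq_integral_exp_smul]
  have h := MeasureTheory.Measure.integral_comp_mul_left
    (fun v : ℝ => Complex.exp (↑(-2 * Real.pi * v * (c⁻¹ * ξ)) * Complex.I) • f v) c
  rw [abs_of_pos (inv_pos.2 hc)] at h
  rw [← h]
  congr 1 with v
  rw [dilate_apply]
  congr 4
  field_simp

open scoped SchwartzMap FourierTransform in
lemma exists_fourier_eq_hatS (s : 𝓢(ℝ, ℝ)) :
    ∃ g : 𝓢(ℝ, ℂ), (∀ x, g x = s (2 * Real.pi * x)) ∧ ∀ ξ, hatS s ξ = 𝓕 g ξ := by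
  refine ⟨dilate (2 * Real.pi) (by positivity) (s.postcompCLM Complex.ofRealCLM),
    fun x => rfl, fun ξ => ?_⟩
  rw [fourier_dilate _ (by positivity), hatS, SchwartzMap.fourier_coe,
    Real.fourier_real_eq_integral_exp_smul]
  congr 2 with v
  rw [SchwartzMap.postcompCLM_apply, smul_eq_mul, mul_comm]
  congr 2
  push_cast
  field_simp

open scoped SchwartzMap FourierTransform in
lemma exists_hatS_decay (s : 𝓢(ℝ, ℝ)) (p : ℕ) :
    ∃ C : ℝ, 0 < C ∧ ∀ ξ, (1 + |ξ|) ^ p * ‖hatS s ξ‖ ≤ C := by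
  obtain ⟨g, -, hg⟩ := exists_fourier_eq_hatS s
  have h := SchwartzMap.one_add_le_sup_seminorm_apply (𝕜 := ℂ) (m := (p, 0)) le_rfl le_rfl (𝓕 g)
  simp only [norm_iteratedFDeriv_zero, Real.norm_eq_abs, ← hg] at h
  exact ⟨max _ 1, by positivity, fun ξ => (h ξ).trans (le_max_left _ _)⟩

open scoped SchwartzMap FourierTransform in
/-- Poisson summation for the dilates of `hatS s`. -/
lemma tsum_hatS (s : 𝓢(ℝ, ℝ)) (hsupp : ∀ x : ℝ, x ∉ Set.Icc (-1 : ℝ) 1 → s x = 0)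
    (hs0 : s 0 = 1) (t : ℝ) (ht : 0 < t) (ht' : t ≤ 1) :
    ∑' k : ℤ, (t : ℂ) * hatS s (t * k) = 1 := by
  obtain ⟨g, hg0, hg⟩ := exists_fourier_eq_hatS s
  have h := SchwartzMap.tsum_eq_tsum_fourier (dilate t⁻¹ (by positivity) g) 0
  simp only [fourier_dilate t⁻¹ (inv_pos.2 ht), dilate_apply, zero_add, inv_inv] at h
  rw [tsum_eq_single 0] at h
  · simp only [Int.cast_zero, mul_zero, hg0, hs0] at h
    simp only [hg]
    rw [← Complex.ofReal_one, h]
    congr 1 with k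
    simp
  · intro k hk
    rw [hg0, hsupp]
    · simp
    · have h1 : (1 : ℝ) ≤ |(k : ℝ)| := by exact_mod_cast Int.one_le_abs hk
      have h2 : 1 ≤ t⁻¹ := (one_le_inv₀ ht).2 ht'
      rw [Set.mem_Icc, ← abs_le, abs_mul, abs_mul, abs_mul, abs_of_pos (inv_pos.2 ht),
        abs_of_pos Real.pi_pos, abs_two]
      have h3 : 1 ≤ t⁻¹ * |(k : ℝ)| := one_le_mul_of_one_le_of_one_le h2 h1
      nlinarith [Real.pi_gt_three]

/-- The average of the indicator of an interval of length `N + 1` over a window reaching it. -/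
lemma le_Md_indicator (c d e n : ℤ) (N : ℕ) (hd : d = c + N) (he : c ≤ e) (he' : e ≤ d) :
    (1 + |(n - e : ℝ)| / (N + 1))⁻¹ ≤ Md (fun m => if m ∈ Set.Icc c d then 1 else 0) n := by
  set f : ℤ → ℝ := fun m => if m ∈ Set.Icc c d then 1 else 0 with hf
  have hbdd : BddAbove (Set.range fun M : ℕ+ => ((M : ℕ) : ℝ)⁻¹ *
      ∑ k ∈ Finset.Ioo (-((M : ℕ) : ℤ)) ((M : ℕ) : ℤ), |f (n - k)|) := by
    refine ⟨2, ?_⟩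
    rintro _ ⟨M, rfl⟩
    have hM : (0 : ℝ) < (M : ℕ) := by exact_mod_cast M.pos
    have h1 : ∑ k ∈ Finset.Ioo (-((M : ℕ) : ℤ)) ((M : ℕ) : ℤ), |f (n - k)| ≤
        ∑ k ∈ Finset.Ioo (-((M : ℕ) : ℤ)) ((M : ℕ) : ℤ), 1 := by
      refine Finset.sum_le_sum fun k _ => ?_
      simp only [hf]
      split_ifs <;> simp
    have h2 : ((Finset.Ioo (-((M : ℕ) : ℤ)) ((M : ℕ) : ℤ)).card : ℝ) ≤ 2 * (M : ℕ) := by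
      have : (Finset.Ioo (-((M : ℕ) : ℤ)) ((M : ℕ) : ℤ)).card ≤ 2 * (M : ℕ) := by
        rw [Int.card_Ioo]
        omega
      exact_mod_cast this
    rw [Finset.sum_const, nsmul_eq_mul, mul_one] at h1
    change _ * _ ≤ _
    rw [inv_mul_le_iff₀ hM]
    linarith
  let M : ℕ+ := ⟨(n - e).natAbs + N + 1, by omega⟩
  refine le_trans ?_ (le_ciSup hbdd M)
  have hMc : ((M : ℕ) : ℝ) = |(n - e : ℝ)| + N + 1 := by
    change (((n - e).natAbs + N + 1 : ℕ) : ℝ) = _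
    push_cast [Nat.cast_natAbs]
    ring
  have hsum : (N + 1 : ℝ) ≤
      ∑ k ∈ Finset.Ioo (-((M : ℕ) : ℤ)) ((M : ℕ) : ℤ), |f (n - k)| := by
    have hsub : (Finset.Icc (n - d) (n - c)) ⊆ Finset.Ioo (-((M : ℕ) : ℤ)) ((M : ℕ) : ℤ) := by
      intro k hk
      have : ((M : ℕ) : ℤ) = (n - e).natAbs + N + 1 := rfl
      rw [Finset.mem_Icc] at hk
      rw [Finset.mem_Ioo, this]
      omega
    refine le_trans ?_ (Finset.sum_le_sum_of_subset_of_nonneg hsub fun _ _ _ => abs_nonneg _)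
    have : ∑ k ∈ Finset.Icc (n - d) (n - c), |f (n - k)| =
        ∑ k ∈ Finset.Icc (n - d) (n - c), 1 := by
      refine Finset.sum_congr rfl fun k hk => ?_
      rw [Finset.mem_Icc] at hk
      simp only [hf]
      rw [if_pos (Set.mem_Icc.2 ⟨by omega, by omega⟩), abs_one]
    rw [this, Finset.sum_const, nsmul_eq_mul, mul_one, Int.card_Icc]
    have : (n - c + 1 - (n - d)).toNat = N + 1 := by omega
    rw [this]
    push_cast
    rfl
  have hM : (0 : ℝ) < (M : ℕ) := by exact_mod_cast M.pos
  refine le_trans (le_of_eq ?_) (mul_le_mul_of_nonneg_left hsum (inv_pos.2 hM).le)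
  rw [hMc]
  have : (0 : ℝ) < |(n - e : ℝ)| + N + 1 := by positivity
  field_simp
  ring

lemma hasSum_weight (t : ℝ) (ht : 0 < t) (ht' : t ≤ 1) :
    ∃ S : ℝ, S ≤ 4 ∧ HasSum (fun k : ℤ => t * ((1 + t * |(k : ℝ)|) ^ 2)⁻¹) S := by
  have key : ∀ m : ℕ, t * ((1 + t * m) ^ 2)⁻¹ ≤ 2 * ((1 + t * m)⁻¹ - (1 + t * (m + 1))⁻¹) := by
    intro m
    have h1 : 0 < 1 + t * m := by positivity
    have h2 : 0 < 1 + t * (m + 1) := by positivity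
    have h3 : 1 + t * (m + 1) ≤ 2 * (1 + t * m) := by nlinarith
    rw [inv_sub_inv h1.ne' h2.ne', ← div_eq_mul_inv, ← mul_div_assoc,
      div_le_div_iff₀ (by positivity) (by positivity)]
    nlinarith [mul_le_mul_of_nonneg_left h3 (mul_pos ht h1).le]
  have hsum : ∀ M : ℕ, ∑ m ∈ Finset.range M, t * ((1 + t * m) ^ 2)⁻¹ ≤ 2 := by
    intro M
    have h : ∑ m ∈ Finset.range M, t * ((1 + t * m) ^ 2)⁻¹ ≤ 2 * (1 - (1 + t * M)⁻¹) := by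
      induction M with
      | zero => simp
      | succ M ih =>
        rw [Finset.sum_range_succ]
        push_cast
        linarith [key M]
    have : 0 < (1 + t * M)⁻¹ := by positivity
    linarith
  have hnn : ∀ m : ℕ, 0 ≤ t * ((1 + t * m) ^ 2)⁻¹ := fun m => by positivity
  have hs : Summable fun m : ℕ => t * ((1 + t * m) ^ 2)⁻¹ := summable_of_sum_range_le hnn hsum
  have hle := Real.tsum_le_of_sum_range_le hnn hsum
  have hs1 : Summable fun m : ℕ => t * ((1 + t * (m + 1 : ℕ)) ^ 2)⁻¹ :=
    (summable_nat_add_iff (f := fun m : ℕ => t * ((1 + t * m) ^ 2)⁻¹) 1).2 hs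
  have hle1 : ∑' m : ℕ, t * ((1 + t * (m + 1 : ℕ)) ^ 2)⁻¹ ≤ 2 := by
    refine (Summable.tsum_le_tsum (fun m => ?_) hs1 hs).trans hle
    push_cast
    gcongr
    linarith
  refine ⟨_, ?_, HasSum.of_nat_of_neg_add_one (f := fun k : ℤ => t * ((1 + t * |(k : ℝ)|) ^ 2)⁻¹)
    (m := ∑' m : ℕ, t * ((1 + t * m) ^ 2)⁻¹)
    (m' := ∑' m : ℕ, t * ((1 + t * (m + 1 : ℕ)) ^ 2)⁻¹) ?_ ?_⟩
  · linarith
  · convert hs.hasSum using 4 with m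
    simp
  · convert hs1.hasSum using 5 with m
    push_cast
    rw [abs_neg, abs_of_nonneg (by positivity)]

lemma abs_sub_le_of_diff_le (q : ℤ → ℝ) (c : ℝ) (n k : ℤ)
    (h : ∀ j : ℤ, |n - j| ≤ |k| → |q (j + 1) - q j| ≤ c) : |q n - q (n - k)| ≤ |(k : ℝ)| * c := by
  have key : ∀ m : ℕ, (m : ℤ) ≤ |k| →
      |q n - q (n + m)| ≤ m * c ∧ |q n - q (n - m)| ≤ m * c := by
    intro m
    induction m with
    | zero => simp
    | succ m ih =>
      intro hm
      push_cast at hm ⊢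
      obtain ⟨h1, h2⟩ := ih (by omega)
      have h3 := h (n + m) (by rw [abs_le]; omega)
      have h4 := h (n - (m + 1)) (by rw [abs_le]; omega)
      rw [show n - (m + 1 : ℤ) + 1 = n - m by ring] at h4
      rw [← add_assoc]
      rw [abs_le] at h1 h2 h3 h4 ⊢
      rw [abs_le]
      refine ⟨⟨?_, ?_⟩, ?_, ?_⟩ <;> linarith
  obtain ⟨h1, h2⟩ := key k.natAbs (Int.natCast_natAbs k).le
  have hc : ((k.natAbs : ℕ) : ℝ) = |(k : ℝ)| := by simp [Nat.cast_natAbs]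
  rw [hc] at h1 h2
  rcases le_total 0 k with hk | hk
  · rwa [Int.natAbs_of_nonneg hk] at h2
  · rwa [Int.ofNat_natAbs_of_nonpos hk, ← sub_eq_add_neg] at h1

section Convolution

variable {t C₁ C₂ : ℝ} {q E : ℤ → ℝ} {K : ℤ → ℂ}

lemma summable_kernel (ht : 0 < t) (ht' : t ≤ 1) (hC₁ : 0 < C₁)
    (hK : ∀ k, ‖K k‖ ≤ C₁ * t * ((1 + t * |(k : ℝ)|) ^ 5)⁻¹) : Summable K := by
  obtain ⟨S, -, hS⟩ := hasSum_weight t ht ht'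
  refine Summable.of_norm_bounded (hS.summable.mul_left C₁) fun k => (hK k).trans ?_
  rw [← mul_assoc]
  have : 1 ≤ 1 + t * |(k : ℝ)| := le_add_of_nonneg_right (by positivity)
  gcongr
  norm_num

lemma summable_conv (ht : 0 < t) (ht' : t ≤ 1) (hC₁ : 0 < C₁)
    (hK : ∀ k, ‖K k‖ ≤ C₁ * t * ((1 + t * |(k : ℝ)|) ^ 5)⁻¹) (hq : ∀ n, |q n| ≤ 1) (n : ℤ) :
    Summable fun k => (q (n - k) : ℂ) * K k := by
  refine Summable.of_norm_bounded (summable_kernel ht ht' hC₁ hK).norm fun k => ?_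
  rw [norm_mul, Complex.norm_real, Real.norm_eq_abs]
  exact mul_le_of_le_one_left (norm_nonneg _) (hq _)

lemma norm_sub_conv_le (ht : 0 < t) (ht' : t ≤ 1) (hC₁ : 0 < C₁) (hC₂ : 0 < C₂)
    (hK : ∀ k, ‖K k‖ ≤ C₁ * t * ((1 + t * |(k : ℝ)|) ^ 5)⁻¹) (hK1 : ∑' k, K k = 1)
    (hq : ∀ n, |q n| ≤ 1) (hE : ∀ n, 0 ≤ E n)
    (hE' : ∀ n j : ℤ, E j ≤ (1 + t * |(n - j : ℝ)|) ^ 2 * E n)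
    (hD : ∀ j, |q (j + 1) - q j| ≤ C₂ * t * E j) (n : ℤ) :
    ‖(q n : ℂ) - ∑' k, (q (n - k) : ℂ) * K k‖ ≤ 4 * C₁ * C₂ * E n := by
  obtain ⟨S, hS4, hS⟩ := hasSum_weight t ht ht'
  have hKs := summable_kernel ht ht' hC₁ hK
  have h0 : (q n : ℂ) - ∑' k, (q (n - k) : ℂ) * K k =
      ∑' k, ((q n - q (n - k) : ℝ) : ℂ) * K k := by
    conv_lhs => rw [← mul_one (q n : ℂ), ← hK1, ← tsum_mul_left]
    rw [← (hKs.mul_left _).tsum_sub (summable_conv ht ht' hC₁ hK hq n)]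
    congr 1 with k
    push_cast
    ring
  rw [h0]
  have hEn := hE n
  have hb := tsum_of_norm_bounded (f := fun k => ((q n - q (n - k) : ℝ) : ℂ) * K k)
    (hS.mul_left (C₁ * C₂ * E n)) ?_
  · refine hb.trans ?_
    nlinarith [mul_nonneg (mul_nonneg hC₁.le hC₂.le) hEn]
  intro k
  have hx : 0 ≤ t * |(k : ℝ)| := by positivity
  set x := t * |(k : ℝ)| with hxdef
  rw [norm_mul, Complex.norm_real, Real.norm_eq_abs]
  have h1 := abs_sub_le_of_diff_le q (C₂ * t * ((1 + x) ^ 2 * E n)) n k (fun j hj => by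
    refine (hD j).trans ?_
    have hj' : |(n - j : ℝ)| ≤ |(k : ℝ)| := by exact_mod_cast hj
    refine mul_le_mul_of_nonneg_left ((hE' n j).trans ?_) (by positivity)
    rw [hxdef]
    gcongr)
  refine (mul_le_mul h1 (hK k) (norm_nonneg _) (by positivity)).trans ?_
  have h2 : |(k : ℝ)| * (C₂ * t * ((1 + x) ^ 2 * E n)) = C₂ * E n * (x * (1 + x) ^ 2) := by
    rw [hxdef]; ring
  rw [h2]
  have h3 : C₂ * E n * (x * (1 + x) ^ 2) * (C₁ * t * ((1 + x) ^ 5)⁻¹) =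
      C₁ * C₂ * E n * (t * ((1 + x) ^ 2)⁻¹) * (x / (1 + x)) := by
    field_simp
  rw [h3]
  exact mul_le_of_le_one_right (by positivity) ((div_le_one (by positivity)).2 (by linarith))

lemma norm_diff_conv_le (ht : 0 < t) (ht' : t ≤ 1) (hC₁ : 0 < C₁) (hC₂ : 0 < C₂)
    (hK : ∀ k, ‖K k‖ ≤ C₁ * t * ((1 + t * |(k : ℝ)|) ^ 5)⁻¹)
    (hq : ∀ n, |q n| ≤ 1) (hE : ∀ n, 0 ≤ E n)
    (hE' : ∀ n j : ℤ, E j ≤ (1 + t * |(n - j : ℝ)|) ^ 2 * E n)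
    (hD : ∀ j, |q (j + 1) - q j| ≤ C₂ * t * E j) (n : ℤ) :
    ‖((q (n + 1) : ℂ) - ∑' k, (q (n + 1 - k) : ℂ) * K k) -
      ((q n : ℂ) - ∑' k, (q (n - k) : ℂ) * K k)‖ ≤ (C₂ + 4 * C₁ * C₂) * t * E n := by
  obtain ⟨S, hS4, hS⟩ := hasSum_weight t ht ht'
  have h0 : ((q (n + 1) : ℂ) - ∑' k, (q (n + 1 - k) : ℂ) * K k) -
      ((q n : ℂ) - ∑' k, (q (n - k) : ℂ) * K k) = ((q (n + 1) - q n : ℝ) : ℂ) -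
      ∑' k, ((q (n - k + 1) - q (n - k) : ℝ) : ℂ) * K k := by
    have : ∑' k, ((q (n - k + 1) - q (n - k) : ℝ) : ℂ) * K k =
        ∑' k, (q (n + 1 - k) : ℂ) * K k - ∑' k, (q (n - k) : ℂ) * K k := by
      rw [← (summable_conv ht ht' hC₁ hK hq (n + 1)).tsum_sub (summable_conv ht ht' hC₁ hK hq n)]
      congr 1 with k
      rw [show n - k + 1 = n + 1 - k by ring]
      push_cast
      ring
    rw [this]
    push_cast
    ring
  rw [h0]
  have hEn := hE n
  have hb := tsum_of_norm_bounded (f := fun k => ((q (n - k + 1) - q (n - k) : ℝ) : ℂ) * K k)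
    (hS.mul_left (C₁ * C₂ * t * E n)) ?_
  · refine (norm_sub_le _ _).trans ?_
    rw [Complex.norm_real, Real.norm_eq_abs]
    nlinarith [mul_nonneg (mul_nonneg (mul_nonneg hC₁.le hC₂.le) ht.le) hEn, hD n]
  intro k
  have hx : 0 ≤ t * |(k : ℝ)| := by positivity
  have h1 := (hD (n - k)).trans (mul_le_mul_of_nonneg_left (hE' n (n - k)) (by positivity))
  rw [show (n - (n - k : ℤ) : ℝ) = k by push_cast; ring] at h1
  set x := t * |(k : ℝ)| with hxdef
  rw [norm_mul, Complex.norm_real, Real.norm_eq_abs]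
  refine (mul_le_mul h1 (hK k) (norm_nonneg _) (by positivity)).trans ?_
  have h3 : C₂ * t * ((1 + x) ^ 2 * E n) * (C₁ * t * ((1 + x) ^ 5)⁻¹) =
      C₁ * C₂ * t * E n * (t * ((1 + x) ^ 2)⁻¹) * (1 / (1 + x)) := by
    field_simp
  rw [h3]
  exact mul_le_of_le_one_right (by positivity) ((div_le_one (by positivity)).2 (by linarith))

end Convolution

lemma Pfun_nonneg (a : ℤ) (N : ℕ) (n : ℤ) : 0 ≤ Pfun a N n := le_max_left _ _

lemma Pfun_le_one (a : ℤ) (N : ℕ) (n : ℤ) : Pfun a N n ≤ 1 :=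
  max_le zero_le_one (sub_le_self _ (by positivity))

lemma Pfun_self (a : ℤ) (N : ℕ) : Pfun a N a = 1 := by simp [Pfun]

lemma Pfun_le_of_le {a n : ℤ} {N : ℕ} (h : (N : ℤ) ≤ |n - a|) :
    Pfun a N n ≤ ((N : ℝ) + 1)⁻¹ := by
  refine max_le (by positivity) ?_
  have h' : (N : ℝ) ≤ |((n - a : ℤ) : ℝ)| := by exact_mod_cast h
  rw [sub_le_iff_le_add, ← one_div, ← add_div, one_le_div (by positivity)]
  linarith

lemma Pfun_eq_zero {a n : ℤ} {N : ℕ} (h : (N : ℤ) + 1 ≤ |n - a|) : Pfun a N n = 0 := by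
  refine max_eq_left ?_
  have h' : (N : ℝ) + 1 ≤ |((n - a : ℤ) : ℝ)| := by exact_mod_cast h
  rw [sub_nonpos, one_le_div (by positivity)]
  exact h'

lemma abs_Pfun_succ_sub_le (a : ℤ) (N : ℕ) (n : ℤ) :
    |Pfun a N (n + 1) - Pfun a N n| ≤ ((N : ℝ) + 1)⁻¹ := by
  refine (abs_max_sub_max_le_max _ _ _ _).trans (max_le (by simp; positivity) ?_)
  rw [sub_sub_sub_cancel_left, ← sub_div, abs_div, abs_of_pos (by positivity : (0 : ℝ) < N + 1),
    ← one_div]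
  refine div_le_div_of_nonneg_right ((abs_abs_sub_abs_le _ _).trans ?_) (by positivity)
  push_cast
  rw [show ((n : ℝ) - a - (n + 1 - a)) = -1 by ring]
  simp

lemma abs_Qfun_le_one (a b : ℤ) (N : ℕ) (n : ℤ) : |Qfun a b N n| ≤ 1 := by
  have h1 := Pfun_nonneg a N n
  have h2 := Pfun_le_one a N n
  have h3 := Pfun_nonneg (b - 1) N n
  have h4 := Pfun_le_one (b - 1) N n
  rw [Qfun]
  split_ifs
  · rw [abs_le]
    constructor <;> linarith
  · simp

lemma abs_Qfun_succ_sub_le {a b : ℤ} {N : ℕ} (hab : (N : ℤ) + 1 ≤ b - a) (n : ℤ) :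
    |Qfun a b N (n + 1) - Qfun a b N n| ≤ 2 * ((N : ℝ) + 1)⁻¹ := by
  have hN : (0 : ℝ) < ((N : ℝ) + 1)⁻¹ := by positivity
  have h1 := abs_Pfun_succ_sub_le a N n
  have h2 := abs_Pfun_succ_sub_le (b - 1) N n
  rw [Qfun, Qfun]
  split_ifs with h3 h4 h4
  · rw [abs_le] at *
    constructor <;> linarith
  · obtain rfl : a = n + 1 := by omega
    have h5 := Pfun_le_of_le (a := b - 1) (n := n + 1) (N := N) (by rw [le_abs]; omega)
    have h6 := Pfun_nonneg (b - 1) N (n + 1)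
    rw [Pfun_self, abs_le]
    constructor <;> linarith
  · obtain rfl : b = n + 1 := by omega
    have h5 := Pfun_le_of_le (a := a) (n := n) (N := N) (by rw [le_abs]; omega)
    have h6 := Pfun_nonneg a N n
    rw [add_sub_cancel_right, Pfun_self, abs_le]
    constructor <;> linarith
  · rw [sub_self, abs_zero]
    positivity

lemma Qfun_succ_eq {a b n : ℤ} {N : ℕ} (ha : (N : ℤ) + 1 < |n - a|)
    (hb : (N : ℤ) + 1 < |n - (b - 1)|) : Qfun a b N (n + 1) = Qfun a b N n := by
  rw [Qfun, Qfun]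
  rw [lt_abs] at ha hb
  have e1 : Pfun a N n = 0 := Pfun_eq_zero (by rw [le_abs]; omega)
  have e2 : Pfun a N (n + 1) = 0 := Pfun_eq_zero (by rw [le_abs]; omega)
  have e3 : Pfun (b - 1) N n = 0 := Pfun_eq_zero (by rw [le_abs]; omega)
  have e4 : Pfun (b - 1) N (n + 1) = 0 := Pfun_eq_zero (by rw [le_abs]; omega)
  rw [e1, e2, e3, e4]
  exact if_congr (by omega) rfl rfl

/-- The quadratically decaying weight centred at `e`, at scale `t⁻¹`. -/
def weight (t : ℝ) (e n : ℤ) : ℝ := ((1 + t * |(n - e : ℝ)|) ^ 2)⁻¹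

lemma weight_nonneg (t : ℝ) (e n : ℤ) : 0 ≤ weight t e n := by
  rw [weight]
  positivity

lemma weight_le {t : ℝ} (ht : 0 < t) (e n j : ℤ) :
    weight t e j ≤ (1 + t * |(n - j : ℝ)|) ^ 2 * weight t e n := by
  rw [weight, weight, ← div_eq_mul_inv, le_div_iff₀ (by positivity),
    inv_mul_le_iff₀ (by positivity), ← mul_pow]
  refine pow_le_pow_left₀ (by positivity) ?_ 2
  have h := abs_sub_le (n : ℝ) j e
  nlinarith [mul_le_mul_of_nonneg_left h ht.le,
    mul_nonneg (mul_nonneg ht.le (abs_nonneg (n - j : ℝ)))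
      (mul_nonneg ht.le (abs_nonneg (j - e : ℝ)))]

lemma weight_lower {t : ℝ} (ht : 0 < t) (ht' : t ≤ 1) {N : ℕ} (hN : t * N ≤ 1) {e n : ℤ}
    (h : |n - e| ≤ (N : ℤ) + 1) : 1 / 9 ≤ weight t e n := by
  have h' : |(n - e : ℝ)| ≤ N + 1 := by exact_mod_cast h
  have h2 : t * |(n - e : ℝ)| ≤ 2 := by nlinarith [mul_le_mul_of_nonneg_left h' ht.le]
  have h3 : 0 ≤ t * |(n - e : ℝ)| := by positivity
  rw [weight, one_div]
  exact inv_anti₀ (by positivity) (by nlinarith)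

lemma weight_le_Md_sq {t : ℝ} {N : ℕ} (hN : ((N : ℝ) + 1)⁻¹ ≤ t) {c d e : ℤ}
    (hd : d = c + N) (he : c ≤ e) (he' : e ≤ d) (n : ℤ) :
    weight t e n ≤ (Md (fun m => if m ∈ Set.Icc c d then 1 else 0) n) ^ 2 := by
  rw [weight, ← inv_pow]
  have h0 : 0 < t := lt_of_lt_of_le (by positivity) hN
  refine pow_le_pow_left₀ (by positivity) ?_ 2
  refine le_trans ?_ (le_Md_indicator c d e n N hd he he')
  refine inv_anti₀ (by positivity) ?_
  rw [div_eq_mul_inv, mul_comm]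
  gcongr

lemma abs_Qfun_succ_sub_le_weight {t : ℝ} (ht : 0 < t) (ht' : t ≤ 1) {a b : ℤ} {N : ℕ}
    (hab : (N : ℤ) + 1 ≤ b - a) (hN : t * N ≤ 1) (hN' : ((N : ℝ) + 1)⁻¹ ≤ t) (n : ℤ) :
    |Qfun a b N (n + 1) - Qfun a b N n| ≤ 18 * t * (weight t a n + weight t (b - 1) n) := by
  have hA := weight_nonneg t a n
  have hB := weight_nonneg t (b - 1) n
  have hD := abs_Qfun_succ_sub_le hab n
  rcases le_or_gt |n - a| ((N : ℤ) + 1) with h | h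
  · nlinarith [weight_lower ht ht' hN h]
  rcases le_or_gt |n - (b - 1)| ((N : ℤ) + 1) with h' | h'
  · nlinarith [weight_lower ht ht' hN h']
  rw [Qfun_succ_eq h h', sub_self, abs_zero]
  positivity

lemma Rfun_eq (s : ℝ → ℝ) (a b : ℤ) (t : ℝ) (n : ℤ) :
    Rfun s a b t n = (Qfun a b (Nat.floor t⁻¹) n : ℂ) -
      ∑' k : ℤ, (Qfun a b (Nat.floor t⁻¹) (n - k) : ℂ) * ((t : ℂ) * hatS s (t * k)) := by
  rw [Rfun, ← (Equiv.subLeft n).tsum_eq]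
  congr 3 with k
  simp

/-- Let `s` be a Schwartz function supported in `[-1,1]` with `s(0)=1`. Then there is a
constant `C > 0` depending only on `s` such that for all integers `a < b` and reals
`t ∈ (0,1/8]` with `(b-a)t > 1`, setting `N = ⌊t⁻¹⌋`, `L = {a,…,a+N}`,
`L' = {b-1-N,…,b-1}`, the symbol `R` satisfies
`|R(n)| ≤ C([M_d χ_L (n)]² + [M_d χ_{L'} (n)]²)` and
`|R(n+1) - R(n)| ≤ C t ([M_d χ_L (n)]² + [M_d χ_{L'} (n)]²)` for all `n ∈ ℤ`. -/
theorem statement13 (s : SchwartzMap ℝ ℝ)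
    (hsupp : ∀ x : ℝ, x ∉ Set.Icc (-1 : ℝ) 1 → s x = 0) (hs0 : s 0 = 1) :
    ∃ C : ℝ, 0 < C ∧
      ∀ (a b : ℤ), a < b →
      ∀ t : ℝ, 0 < t → t ≤ 1 / 8 → 1 < ((b : ℝ) - (a : ℝ)) * t →
        ∀ n : ℤ,
          (‖Rfun (⇑s) a b t n‖ ≤
            C * ((Md (fun m => if m ∈ Set.Icc a (a + (Nat.floor t⁻¹ : ℤ)) then 1 else 0) n) ^ 2 +
              (Md (fun m => if m ∈ Set.Icc (b - 1 - (Nat.floor t⁻¹ : ℤ)) (b - 1) then 1 else 0) n) ^ 2)) ∧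
          (‖Rfun (⇑s) a b t (n + 1) - Rfun (⇑s) a b t n‖ ≤
            C * t * ((Md (fun m => if m ∈ Set.Icc a (a + (Nat.floor t⁻¹ : ℤ)) then 1 else 0) n) ^ 2 +
              (Md (fun m => if m ∈ Set.Icc (b - 1 - (Nat.floor t⁻¹ : ℤ)) (b - 1) then 1 else 0) n) ^ 2)) := by
  obtain ⟨C₁, hC₁, hdecay⟩ := exists_hatS_decay s 5
  refine ⟨18 + 4 * C₁ * 18, by positivity, fun a b _ t ht ht8 hbt n => ?_⟩
  have ht1 : t ≤ 1 := by linarith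
  have hti : 0 < t⁻¹ := inv_pos.2 ht
  simp only [Rfun_eq]
  have hfl := Nat.floor_le hti.le
  have hfl' := Nat.lt_floor_add_one t⁻¹
  have hab : (Nat.floor t⁻¹ : ℤ) + 1 ≤ b - a := by
    have h : (Nat.floor t⁻¹ : ℝ) < b - a :=
      hfl.trans_lt (by rwa [inv_lt_iff_one_lt_mul₀ ht])
    have : (Nat.floor t⁻¹ : ℤ) < b - a := by exact_mod_cast h
    omega
  set N := Nat.floor t⁻¹
  have hN : t * N ≤ 1 := by
    rw [← mul_inv_cancel₀ ht.ne']
    exact mul_le_mul_of_nonneg_left hfl ht.le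
  have hN' : ((N : ℝ) + 1)⁻¹ ≤ t := inv_le_of_inv_le₀ ht hfl'.le
  have hMa := weight_le_Md_sq hN' (c := a) (d := a + N) (e := a) rfl le_rfl (by omega) n
  have hMb := weight_le_Md_sq hN' (c := b - 1 - N) (d := b - 1) (e := b - 1) (by ring)
    (by omega) le_rfl n
  have hK : ∀ k : ℤ, ‖(t : ℂ) * hatS s (t * k)‖ ≤ C₁ * t * ((1 + t * |(k : ℝ)|) ^ 5)⁻¹ := by
    intro k
    have h := hdecay (t * k)
    rw [abs_mul, abs_of_pos ht] at h
    rw [norm_mul, Complex.norm_real, Real.norm_eq_abs, abs_of_pos ht, ← div_eq_mul_inv,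
      le_div_iff₀ (by positivity)]
    nlinarith [mul_le_mul_of_nonneg_left h ht.le]
  have hq := abs_Qfun_le_one a b N
  have hE : ∀ m, 0 ≤ weight t a m + weight t (b - 1) m := fun m =>
    add_nonneg (weight_nonneg _ _ _) (weight_nonneg _ _ _)
  have hE' : ∀ m j : ℤ, weight t a j + weight t (b - 1) j ≤
      (1 + t * |(m - j : ℝ)|) ^ 2 * (weight t a m + weight t (b - 1) m) := fun m j => by
    rw [mul_add]
    exact add_le_add (weight_le ht _ _ _) (weight_le ht _ _ _)
  have hD := abs_Qfun_succ_sub_le_weight ht ht1 hab hN hN'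
  have hEn := hE n
  constructor
  · refine (norm_sub_conv_le ht ht1 hC₁ (by norm_num) hK (tsum_hatS s hsupp hs0 t ht ht1)
      hq hE hE' hD n).trans ?_
    exact mul_le_mul (by linarith) (add_le_add hMa hMb) hEn (by positivity)
  · refine (norm_diff_conv_le ht ht1 hC₁ (by norm_num) hK hq hE hE' hD n).trans ?_
    exact mul_le_mul_of_nonneg_left (add_le_add hMa hMb) (by positivity)

end
end

section
/- There exists an absolute constant A > 0 such that for every strictly increasing sequence Λ = (λ_j)_{j∈ℕ₀} of positive integers with σ_Λ < ∞ and every f ∈ L¹(𝕋) with ∫_𝕋 |f(x)| log^{1/2}(e+|f(x)|) dx < ∞, one has (Σ_{j∈ℕ₀} |f̂(λ_j)|²)^{1/2} ≤ A σ_Λ^{1/2} [1 + (2π)^{-1}∫_𝕋 |f(x)| log^{1/2}(e + |f(x)|) dx]. -/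
open MeasureTheory Real Complex
open scoped ENNReal

noncomputable section

/-- `σ_Λ = sup_{N≥1} #(Λ ∩ {2^{N-1},…,2^N})`, where `Λ` is identified with its range. -/
def sigmaT (Λ : ℕ → ℕ) : ℕ :=
  sSup {m : ℕ | ∃ N : ℕ, m = (Set.range Λ ∩ Set.Icc (2 ^ N) (2 ^ (N + 1))).ncard}

instance : IsProbabilityMeasure haarT :=
  inferInstanceAs (IsProbabilityMeasure AddCircle.haarAddCircle)

/-- A continuous function on the torus is integrable. -/
lemma integrable_haarT_of_continuous {E : Type*} [NormedAddCommGroup E] {g : Tor → E}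
    (hg : Continuous g) : Integrable g haarT :=
  hg.integrable_of_hasCompactSupport (HasCompactSupport.of_compactSpace g)

lemma integral_fourier_eq_zero {k : ℤ} (hk : k ≠ 0) : ∫ x : Tor, fourier k x ∂haarT = 0 := by
  have h := congrFun (fourierCoeff_fourier (T := 2 * π) k) 0
  rw [Pi.single_eq_of_ne hk.symm] at h
  simpa [fourierCoeff, haarT] using h

/-- The `N`-th Riesz product with frequencies `n j`, constant terms `c j` and weights `w j`. -/
def rieszProduct (n : ℕ → ℕ) (c : ℕ → ℝ) (w : ℕ → ℂ) (N : ℕ) (x : Tor) : ℝ :=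
  ∏ j ∈ Finset.range N, (c j + (w j * fourier (n j : ℤ) x).re)

lemma continuous_rieszProduct (n : ℕ → ℕ) (c : ℕ → ℝ) (w : ℕ → ℂ) (N : ℕ) :
    Continuous (rieszProduct n c w N) := by
  unfold rieszProduct
  fun_prop

/-- Frequency expansion of one step of a Riesz product. -/
lemma integral_rieszProduct_succ_mul_fourier (n : ℕ → ℕ) (c : ℕ → ℝ) (w : ℕ → ℂ) (N : ℕ) (k : ℤ) :
    ∫ x, (rieszProduct n c w (N + 1) x : ℂ) * fourier k x ∂haarT =
      c N * ∫ x, (rieszProduct n c w N x : ℂ) * fourier k x ∂haarT +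
      w N / 2 * ∫ x, (rieszProduct n c w N x : ℂ) * fourier (k + n N) x ∂haarT +
      (starRingEnd ℂ) (w N) / 2 *
        ∫ x, (rieszProduct n c w N x : ℂ) * fourier (k - n N) x ∂haarT := by
  have hP := continuous_rieszProduct n c w N
  have hi (l : ℤ) : Integrable (fun x => (rieszProduct n c w N x : ℂ) * fourier l x) haarT :=
    integrable_haarT_of_continuous (by fun_prop)
  rw [← integral_const_mul, ← integral_const_mul, ← integral_const_mul,
    ← integral_add ((hi _).const_mul _) ((hi _).const_mul _),
    ← integral_add (by exact ((hi _).const_mul _).add ((hi _).const_mul _))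
      ((hi _).const_mul _)]
  refine integral_congr_ae (Filter.Eventually.of_forall fun x => ?_)
  have hre : (((w N * fourier (n N : ℤ) x).re : ℝ) : ℂ) =
      (w N * fourier (n N : ℤ) x +
        (starRingEnd ℂ) (w N) * fourier (-(n N : ℤ)) x) / 2 := by
    rw [Complex.re_eq_add_conj, map_mul, fourier_neg]
  simp only [rieszProduct, Finset.prod_range_succ, Complex.ofReal_mul, Complex.ofReal_add, hre,
    sub_eq_add_neg, fourier_add]
  ring

/-- The spectrum of a Riesz product is contained in `[-∑ n j, ∑ n j]`. -/
lemma integral_rieszProduct_mul_fourier_eq_zero (n : ℕ → ℕ) (c : ℕ → ℝ) (w : ℕ → ℂ) (N : ℕ) :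
    ∀ k : ℤ, ((∑ j ∈ Finset.range N, n j : ℕ) : ℤ) < |k| →
      ∫ x, (rieszProduct n c w N x : ℂ) * fourier k x ∂haarT = 0 := by
  induction N with
  | zero =>
    intro k hk
    have hk0 : k ≠ 0 := by
      rintro rfl
      simp at hk
    simpa [rieszProduct] using integral_fourier_eq_zero hk0
  | succ N ih =>
    intro k hk
    rw [Finset.sum_range_succ, Nat.cast_add] at hk
    rw [integral_rieszProduct_succ_mul_fourier, ih k (by grind), ih (k + n N) (by grind),
      ih (k - n N) (by grind)]
    simp

lemma integral_rieszProduct {n : ℕ → ℕ} (hn : ∀ N, ∑ j ∈ Finset.range N, n j < n N)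
    (c : ℕ → ℝ) (w : ℕ → ℂ) (N : ℕ) :
    ∫ x, rieszProduct n c w N x ∂haarT = ∏ j ∈ Finset.range N, c j := by
  suffices h : ∫ x, (rieszProduct n c w N x : ℂ) * fourier 0 x ∂haarT =
      ((∏ j ∈ Finset.range N, c j : ℝ) : ℂ) by
    simp only [fourier_zero, mul_one] at h
    rw [integral_complex_ofReal] at h
    exact_mod_cast h
  induction N with
  | zero => simp [rieszProduct]
  | succ N ih =>
    have hN : ((∑ j ∈ Finset.range N, n j : ℕ) : ℤ) < n N := by exact_mod_cast hn N
    rw [integral_rieszProduct_succ_mul_fourier, ih,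
      integral_rieszProduct_mul_fourier_eq_zero n c w N (0 + n N) (by grind),
      integral_rieszProduct_mul_fourier_eq_zero n c w N (0 - n N) (by grind),
      Finset.prod_range_succ]
    push_cast
    ring

lemma exp_re_mul_le (b z : ℂ) (hz : ‖z‖ = 1) :
    Real.exp (b * z).re ≤ Real.cosh ‖b‖ + ((Real.sinh ‖b‖ / ‖b‖ : ℝ) * b * z).re := by
  rcases eq_or_ne b 0 with rfl | hb
  · simp
  have hb' : ‖b‖ ≠ 0 := norm_ne_zero_iff.2 hb
  have ht : |(b * z).re / ‖b‖| ≤ 1 := by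
    rw [abs_div, abs_norm, div_le_one (norm_pos_iff.2 hb)]
    simpa [hz] using Complex.abs_re_le_norm (b * z)
  have h := Real.exp_mul_le_cosh_add_mul_sinh ht ‖b‖
  rw [div_mul_cancel₀ _ hb'] at h
  rw [mul_assoc, Complex.re_ofReal_mul]
  exact h.trans (le_of_eq (by ring))

/-- Dissociate exponential sums are subgaussian. -/
lemma integral_exp_re_sum_le {n : ℕ → ℕ} (hn : ∀ N, ∑ j ∈ Finset.range N, n j < n N)
    (b : ℕ → ℂ) (N : ℕ) :
    ∫ x : Tor, Real.exp (∑ j ∈ Finset.range N, b j * fourier (n j : ℤ) x).re ∂haarT ≤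
      Real.exp ((∑ j ∈ Finset.range N, ‖b j‖ ^ 2) / 2) := by
  have h1 : ∀ x : Tor, Real.exp (∑ j ∈ Finset.range N, b j * fourier (n j : ℤ) x).re ≤
      rieszProduct n (fun j => Real.cosh ‖b j‖)
        (fun j => (Real.sinh ‖b j‖ / ‖b j‖ : ℝ) * b j) N x := by
    intro x
    rw [Complex.re_sum, Real.exp_sum]
    exact Finset.prod_le_prod (fun _ _ => (Real.exp_pos _).le)
      fun j _ => exp_re_mul_le _ _ (by rw [fourier_apply, Circle.norm_coe])
  refine (integral_mono (integrable_haarT_of_continuous (by fun_prop))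
    (integrable_haarT_of_continuous (continuous_rieszProduct _ _ _ _)) h1).trans ?_
  rw [integral_rieszProduct hn, Finset.sum_div, Real.exp_sum]
  exact Finset.prod_le_prod (fun _ _ => (Real.cosh_pos _).le)
    fun j _ => Real.cosh_le_exp_half_sq _

/-- A Young-type inequality for the pair `u √log(e + u)` and Gaussian exponentials. -/
lemma mul_abs_le_add_sum_exp {u v : ℝ} (hu : 0 ≤ u) {M : ℕ} (hv : |v| ≤ M) :
    u * |v| ≤ 8 * (u * Real.sqrt (Real.log (Real.exp 1 + u))) +
      8 * ∑ m ∈ Finset.range (M + 1),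
        Real.exp (-3 * (m : ℝ) ^ 2 / 4) * (Real.exp (m * v) + Real.exp (-m * v)) := by
  have hlog : 1 ≤ Real.log (Real.exp 1 + u) := by
    rw [Real.le_log_iff_exp_le (by positivity)]
    linarith
  set L := Real.sqrt (Real.log (Real.exp 1 + u)) with hL
  have hL1 : 1 ≤ L := Real.one_le_sqrt.2 hlog
  have hterm : ∀ m : ℕ, 0 ≤
      Real.exp (-3 * (m : ℝ) ^ 2 / 4) * (Real.exp (m * v) + Real.exp (-m * v)) :=
    fun m => by positivity
  rcases le_or_gt |v| (8 * L) with h | h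
  · have h0 := Finset.sum_nonneg fun m (_ : m ∈ Finset.range (M + 1)) => hterm m
    nlinarith [mul_le_mul_of_nonneg_left h hu]
  have hm1 : (⌊|v|⌋₊ : ℝ) ≤ |v| := Nat.floor_le (abs_nonneg v)
  have hm2 : |v| < ⌊|v|⌋₊ + 1 := Nat.lt_floor_add_one _
  have hmM : ⌊|v|⌋₊ ∈ Finset.range (M + 1) := by
    rw [Finset.mem_range, Nat.lt_succ_iff]
    exact_mod_cast hm1.trans hv
  refine le_trans ?_ (le_add_of_nonneg_of_le (by positivity)
    (mul_le_mul_of_nonneg_left (Finset.single_le_sum (fun m _ => hterm m) hmM) (by norm_num)))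
  generalize (⌊|v|⌋₊ : ℝ) = m at hm1 hm2
  have hu2 : u ≤ Real.exp (|v| ^ 2 / 64) := by
    have h2 : Real.exp 1 + u = Real.exp (L ^ 2) := by
      rw [hL, Real.sq_sqrt (by linarith), Real.exp_log (by positivity)]
    have h3 : L ^ 2 ≤ |v| ^ 2 / 64 := by nlinarith
    linarith [Real.exp_le_exp.2 h3, Real.exp_pos 1]
  have hv2 : |v| ≤ 8 * Real.exp (|v| ^ 2 / 64) := by
    nlinarith [Real.add_one_le_exp (|v| ^ 2 / 64), sq_nonneg (|v| - 4)]
  have hexp : Real.exp (m * |v|) ≤ Real.exp (m * v) + Real.exp (-m * v) := by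
    rcases abs_cases v with ⟨h', _⟩ | ⟨h', _⟩ <;> rw [h']
    · linarith [Real.exp_pos (-m * v)]
    · rw [mul_neg, ← neg_mul]
      linarith [Real.exp_pos (m * v)]
  calc u * |v| ≤ Real.exp (|v| ^ 2 / 64) * (8 * Real.exp (|v| ^ 2 / 64)) :=
        mul_le_mul hu2 hv2 (abs_nonneg v) (Real.exp_pos _).le
    _ = 8 * Real.exp (|v| ^ 2 / 32) := by
        rw [mul_left_comm, ← Real.exp_add]
        ring_nf
    _ ≤ 8 * Real.exp (-3 * m ^ 2 / 4 + m * |v|) := by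
        gcongr
        nlinarith
    _ ≤ _ := by
        rw [Real.exp_add]
        gcongr

/-- The numerical constant `∑ exp(-m/4)`. -/
def gaussConst : ℝ := ∑' m : ℕ, Real.exp (-(1 / 4)) ^ m

lemma sum_exp_neg_sq_le (M : ℕ) :
    ∑ m ∈ Finset.range M, Real.exp (-(m : ℝ) ^ 2 / 4) ≤ gaussConst := by
  have hs : Summable fun m : ℕ => Real.exp (-(1 / 4)) ^ m :=
    summable_geometric_of_lt_one (Real.exp_pos _).le (by simp)
  refine le_trans (Finset.sum_le_sum fun m _ => ?_)
    (hs.sum_le_tsum (Finset.range M) fun _ _ => by positivity)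
  rw [← Real.exp_nat_mul]
  refine Real.exp_le_exp.2 ?_
  have : (m : ℝ) ≤ (m : ℝ) ^ 2 := by exact_mod_cast Nat.le_self_pow two_ne_zero m
  linarith

lemma gaussConst_nonneg : 0 ≤ gaussConst := tsum_nonneg fun _ => by positivity

/-- Pairing of an `L log^{1/2} L` function with a subgaussian function. -/
lemma integral_norm_mul_abs_le {f : Tor → ℂ} (hf : Integrable f haarT)
    (hfL : Integrable (fun x => ‖f x‖ * Real.sqrt (Real.log (Real.exp 1 + ‖f x‖))) haarT)
    {v : Tor → ℝ} (hv : Continuous v)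
    (hsub : ∀ s : ℝ, ∫ x, Real.exp (s * v x) ∂haarT ≤ Real.exp (s ^ 2 / 2)) :
    ∫ x, ‖f x‖ * |v x| ∂haarT ≤
      8 * ∫ x, ‖f x‖ * Real.sqrt (Real.log (Real.exp 1 + ‖f x‖)) ∂haarT + 16 * gaussConst := by
  obtain ⟨C, hC⟩ := (isCompact_range hv).isBounded.exists_norm_le
  obtain ⟨M, hM⟩ := exists_nat_ge C
  have hvM (x : Tor) : |v x| ≤ M := (hC _ ⟨x, rfl⟩).trans hM
  have hexp (s : ℝ) : Integrable (fun x => Real.exp (s * v x)) haarT :=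
    integrable_haarT_of_continuous (by fun_prop)
  have hterm (m : ℕ) : Integrable (fun x => Real.exp (-3 * (m : ℝ) ^ 2 / 4) *
      (Real.exp (m * v x) + Real.exp (-m * v x))) haarT :=
    ((hexp _).add (hexp _)).const_mul _
  have hsum := integrable_finsetSum (Finset.range (M + 1)) fun m _ => hterm m
  have hleft : Integrable (fun x => ‖f x‖ * |v x|) haarT :=
    hf.norm.mul_bdd (c := M) hv.abs.aestronglyMeasurable
      (Filter.Eventually.of_forall fun x => by simpa using hvM x)
  refine (integral_mono hleft ((hfL.const_mul 8).add (hsum.const_mul 8))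
    fun x => mul_abs_le_add_sum_exp (norm_nonneg (f x)) (hvM x)).trans ?_
  simp only [Pi.add_apply]
  rw [integral_add (hfL.const_mul 8) (hsum.const_mul 8), integral_const_mul, integral_const_mul,
    integral_finsetSum _ fun m _ => hterm m]
  have hbound : ∀ m ∈ Finset.range (M + 1), ∫ x, Real.exp (-3 * (m : ℝ) ^ 2 / 4) *
      (Real.exp (m * v x) + Real.exp (-m * v x)) ∂haarT ≤
        2 * Real.exp (-(m : ℝ) ^ 2 / 4) := by
    intro m _
    rw [integral_const_mul, integral_add (hexp _) (hexp _)]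
    have h1 := hsub m
    have h2 := hsub (-m)
    rw [neg_sq] at h2
    calc _ ≤ Real.exp (-3 * (m : ℝ) ^ 2 / 4) * (2 * Real.exp ((m : ℝ) ^ 2 / 2)) := by
          gcongr
          linarith
      _ = _ := by
          rw [mul_left_comm, ← Real.exp_add]
          ring_nf
  have h3 := Finset.sum_le_sum hbound
  rw [← Finset.mul_sum] at h3
  linarith [sum_exp_neg_sq_le (M + 1)]

lemma integral_norm_mul_norm_sum_le {f : Tor → ℂ} (hf : Integrable f haarT)
    (hfL : Integrable (fun x => ‖f x‖ * Real.sqrt (Real.log (Real.exp 1 + ‖f x‖))) haarT)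
    {n : ℕ → ℕ} (hn : ∀ N, ∑ j ∈ Finset.range N, n j < n N) (b : ℕ → ℂ) (N : ℕ)
    (hb : ∑ j ∈ Finset.range N, ‖b j‖ ^ 2 ≤ 1) :
    ∫ x, ‖f x‖ * ‖∑ j ∈ Finset.range N, b j * fourier (n j : ℤ) x‖ ∂haarT ≤
      16 * ∫ x, ‖f x‖ * Real.sqrt (Real.log (Real.exp 1 + ‖f x‖)) ∂haarT + 32 * gaussConst := by
  set g : Tor → ℂ := fun x => ∑ j ∈ Finset.range N, b j * fourier (n j : ℤ) x with hg
  have hgc : Continuous g := by fun_prop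
  have hsub (a : ℂ) (ha : ‖a‖ = 1) (s : ℝ) :
      ∫ x, Real.exp (s * (a * g x).re) ∂haarT ≤ Real.exp (s ^ 2 / 2) := by
    have h := integral_exp_re_sum_le hn (fun j => s * a * b j) N
    have h1 (x : Tor) : s * (a * g x).re =
        (∑ j ∈ Finset.range N, s * a * b j * fourier (n j : ℤ) x).re := by
      rw [← Complex.re_ofReal_mul, ← mul_assoc, hg, Finset.mul_sum]
      simp only [mul_assoc]
    simp only [h1]
    refine h.trans (Real.exp_le_exp.2 ?_)
    simp only [norm_mul, ha, Complex.norm_real, mul_one, mul_pow, ← Finset.mul_sum,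
      Real.norm_eq_abs, sq_abs]
    nlinarith [sq_nonneg s]
  have hprod (a : ℂ) : Integrable (fun x => ‖f x‖ * |(a * g x).re|) haarT := by
    have hc : Continuous fun x => |(a * g x).re| := by fun_prop
    obtain ⟨C, hC⟩ := (isCompact_range hc).isBounded.exists_norm_le
    exact hf.norm.mul_bdd (c := C) hc.aestronglyMeasurable
      (Filter.Eventually.of_forall fun x => hC _ ⟨x, rfl⟩)
  have h1 := integral_norm_mul_abs_le hf hfL (v := fun x => (1 * g x).re) (by fun_prop)
    (hsub 1 (by simp))
  have h2 := integral_norm_mul_abs_le hf hfL (v := fun x => (-I * g x).re) (by fun_prop)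
    (hsub (-I) (by simp))
  have h3 : ∫ x, ‖f x‖ * ‖g x‖ ∂haarT ≤
      ∫ x, (‖f x‖ * |(1 * g x).re| + ‖f x‖ * |(-I * g x).re|) ∂haarT := by
    refine integral_mono_of_nonneg (Filter.Eventually.of_forall fun x => by positivity)
      ((hprod 1).add (hprod (-I))) (Filter.Eventually.of_forall fun x => ?_)
    dsimp only
    rw [← mul_add]
    refine mul_le_mul_of_nonneg_left ?_ (norm_nonneg _)
    simpa using Complex.norm_le_abs_re_add_abs_im (g x)
  rw [integral_add (hprod 1) (hprod (-I))] at h3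
  linarith

lemma sqrt_sum_sq_fourierCoeff_le {f : Tor → ℂ} (hf : Integrable f haarT)
    (hfL : Integrable (fun x => ‖f x‖ * Real.sqrt (Real.log (Real.exp 1 + ‖f x‖))) haarT)
    {n : ℕ → ℕ} (hn : ∀ N, ∑ j ∈ Finset.range N, n j < n N) (N : ℕ) :
    Real.sqrt (∑ j ∈ Finset.range N, ‖fourierCoeff f (n j : ℤ)‖ ^ 2) ≤
      16 * ∫ x, ‖f x‖ * Real.sqrt (Real.log (Real.exp 1 + ‖f x‖)) ∂haarT + 32 * gaussConst := by
  set F : ℕ → ℂ := fun j => fourierCoeff f (n j : ℤ) with hF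
  set S := Real.sqrt (∑ j ∈ Finset.range N, ‖F j‖ ^ 2) with hS
  have hS2 : S ^ 2 = ∑ j ∈ Finset.range N, ‖F j‖ ^ 2 := Real.sq_sqrt (by positivity)
  have hint (j : ℕ) : Integrable (fun x => fourier (-(n j : ℤ)) x • f x) haarT :=
    hf.fourier_smul _
  have hb : ∑ j ∈ Finset.range N, ‖F j / S‖ ^ 2 ≤ 1 := by
    simp only [norm_div, Complex.norm_real, div_pow, ← Finset.sum_div, Real.norm_eq_abs, sq_abs]
    rw [← hS2]
    exact div_self_le_one _
  refine le_trans ?_ (integral_norm_mul_norm_sum_le hf hfL hn (fun j => F j / S) N hb)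
  have hdual : (S : ℂ) = ∫ x, f x *
      (starRingEnd ℂ) (∑ j ∈ Finset.range N, F j / S * fourier (n j : ℤ) x) ∂haarT := by
    have h1 (x : Tor) : f x *
        (starRingEnd ℂ) (∑ j ∈ Finset.range N, F j / S * fourier (n j : ℤ) x) =
        ∑ j ∈ Finset.range N,
          (starRingEnd ℂ) (F j) / S * (fourier (-(n j : ℤ)) x • f x) := by
      rw [map_sum, Finset.mul_sum]
      refine Finset.sum_congr rfl fun j _ => ?_
      rw [map_mul, map_div₀, Complex.conj_ofReal, fourier_neg, smul_eq_mul]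
      ring
    simp only [h1]
    rw [integral_finsetSum _ fun j _ => (hint j).const_mul _]
    have h2 : ∀ j ∈ Finset.range N, ∫ x, (starRingEnd ℂ) (F j) / S *
        (fourier (-(n j : ℤ)) x • f x) ∂haarT = ((‖F j‖ ^ 2 : ℝ) : ℂ) / S := by
      intro j _
      rw [integral_const_mul]
      change (starRingEnd ℂ) (F j) / S * F j = _
      rw [div_mul_eq_mul_div, Complex.conj_mul', Complex.ofReal_pow]
    rw [Finset.sum_congr rfl h2, ← Finset.sum_div, ← Complex.ofReal_sum, ← hS2,
      ← Complex.ofReal_div, sq, mul_self_div_self]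
  calc S = ‖(S : ℂ)‖ := by rw [Complex.norm_real, Real.norm_of_nonneg (Real.sqrt_nonneg _)]
    _ ≤ _ := by
      conv_lhs => rw [hdual]
      refine (norm_integral_le_integral_norm _).trans (le_of_eq ?_)
      simp only [norm_mul, RCLike.norm_conj]

lemma sum_range_lt_of_two_mul_le {n : ℕ → ℕ} (h0 : 0 < n 0) (h : ∀ j, 2 * n j ≤ n (j + 1))
    (N : ℕ) : ∑ j ∈ Finset.range N, n j < n N := by
  induction N with
  | zero => simpa using h0
  | succ N ih =>
    rw [Finset.sum_range_succ]
    linarith [h N]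

lemma sum_range_mul_eq_sum_sum {M : Type*} [AddCommMonoid M] (a : ℕ → M) (q N : ℕ) :
    ∑ j ∈ Finset.range (q * N), a j =
      ∑ r ∈ Finset.range q, ∑ k ∈ Finset.range N, a (r + q * k) := by
  induction N with
  | zero => simp
  | succ N ih =>
    rw [Nat.mul_succ, Finset.sum_range_add, ih]
    simp only [Finset.sum_range_succ, Finset.sum_add_distrib, add_comm (q * N)]

lemma card_le_sigmaT {Λ : ℕ → ℕ} (hΛ : StrictMono Λ)
    (hbdd : BddAbove
      {m : ℕ | ∃ N : ℕ, m = (Set.range Λ ∩ Set.Icc (2 ^ N) (2 ^ (N + 1))).ncard})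
    (N : ℕ) (s : Finset ℕ) (hs : ∀ j ∈ s, Λ j ∈ Set.Icc (2 ^ N) (2 ^ (N + 1))) :
    s.card ≤ sigmaT Λ := by
  refine le_trans ?_ (le_csSup hbdd ⟨N, rfl⟩)
  rw [← Finset.card_image_of_injective s hΛ.injective, ← Set.ncard_coe_finset]
  refine Set.ncard_le_ncard ?_ ((Set.finite_Icc _ _).inter_of_right _)
  intro y hy
  obtain ⟨j, hj, rfl⟩ := Finset.mem_image.1 (Finset.mem_coe.1 hy)
  exact ⟨⟨j, rfl⟩, hs j hj⟩

lemma two_mul_le_of_sigmaT {Λ : ℕ → ℕ} (hΛ : StrictMono Λ) (hpos : 0 < Λ 0)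
    (hbdd : BddAbove
      {m : ℕ | ∃ N : ℕ, m = (Set.range Λ ∩ Set.Icc (2 ^ N) (2 ^ (N + 1))).ncard})
    (j : ℕ) : 2 * Λ j ≤ Λ (j + 2 * sigmaT Λ) := by
  have hj : Λ j ≠ 0 := (hpos.trans_le (hΛ.monotone j.zero_le)).ne'
  set N := Nat.log 2 (Λ j) with hN
  have h1 : 2 ^ N ≤ Λ j := Nat.pow_log_le_self 2 hj
  have h2 : Λ j < 2 ^ (N + 1) := Nat.lt_pow_succ_log_self (by norm_num) _
  by_contra! hlt
  have h3 : Λ (j + 2 * sigmaT Λ) < 2 ^ (N + 2) := by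
    rw [pow_succ]
    omega
  set I := Finset.Icc j (j + 2 * sigmaT Λ) with hI
  have hA := card_le_sigmaT hΛ hbdd N (I.filter fun i => Λ i < 2 ^ (N + 1)) fun i hi => by
    rw [Finset.mem_filter, hI, Finset.mem_Icc] at hi
    exact ⟨h1.trans (hΛ.monotone hi.1.1), hi.2.le⟩
  have hB := card_le_sigmaT hΛ hbdd (N + 1) (I.filter fun i => ¬ Λ i < 2 ^ (N + 1))
    fun i hi => by
      rw [Finset.mem_filter, hI, Finset.mem_Icc] at hi
      exact ⟨not_lt.1 hi.2, ((hΛ.monotone hi.1.2).trans_lt h3).le⟩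
  have hcard := Finset.card_filter_add_card_filter_not (s := I) fun i => Λ i < 2 ^ (N + 1)
  have hI' : I.card = 2 * sigmaT Λ + 1 := by
    rw [hI, Nat.card_Icc]
    omega
  omega

lemma sigmaT_pos {Λ : ℕ → ℕ} (hΛ : StrictMono Λ) (hpos : 0 < Λ 0)
    (hbdd : BddAbove
      {m : ℕ | ∃ N : ℕ, m = (Set.range Λ ∩ Set.Icc (2 ^ N) (2 ^ (N + 1))).ncard}) :
    0 < sigmaT Λ := by
  by_contra! h
  have := two_mul_le_of_sigmaT hΛ hpos hbdd 0
  simp only [Nat.le_zero.1 h, mul_zero, add_zero] at this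
  omega

/-- Zygmund's inequality with explicit dependence on `σ_Λ`: there is an absolute `A > 0`
such that for every strictly increasing sequence `Λ` of positive integers with `σ_Λ < ∞`
and every `f` with `∫ |f| log^{1/2}(e+|f|) < ∞`,
`(Σ_j |f̂(λ_j)|²)^{1/2} ≤ A σ_Λ^{1/2} [1 + (2π)⁻¹ ∫ |f| log^{1/2}(e + |f|)]`. -/
theorem statement15 :
    ∃ A : ℝ, 0 < A ∧
      ∀ (Λ : ℕ → ℕ), StrictMono Λ → 0 < Λ 0 →
      BddAbove {m : ℕ | ∃ N : ℕ, m = (Set.range Λ ∩ Set.Icc (2 ^ N) (2 ^ (N + 1))).ncard} →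
      ∀ f : Tor → ℂ, Integrable f haarT →
        Integrable (fun x => ‖f x‖ * Real.sqrt (Real.log (Real.exp 1 + ‖f x‖))) haarT →
        Real.sqrt (∑' j : ℕ, ‖fourierCoeff f (Λ j : ℤ)‖ ^ 2) ≤
          A * Real.sqrt (sigmaT Λ) *
            (1 + ∫ x, ‖f x‖ * Real.sqrt (Real.log (Real.exp 1 + ‖f x‖)) ∂haarT) := by
  refine ⟨Real.sqrt 2 * (16 + 32 * gaussConst), ?_, ?_⟩
  · have := gaussConst_nonneg
    positivity
  intro Λ hΛ hpos hbdd f hf hfL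
  set J := ∫ x, ‖f x‖ * Real.sqrt (Real.log (Real.exp 1 + ‖f x‖)) ∂haarT with hJ
  have hJ0 : 0 ≤ J := integral_nonneg fun x => by positivity
  set B := 16 * J + 32 * gaussConst with hB
  have hK := gaussConst_nonneg
  have hB0 : 0 ≤ B := by positivity
  have hσ := sigmaT_pos hΛ hpos hbdd
  set q := 2 * sigmaT Λ with hq
  have hclass (r N : ℕ) :
      ∑ k ∈ Finset.range N, ‖fourierCoeff f (Λ (r + q * k) : ℤ)‖ ^ 2 ≤ B ^ 2 := by
    refine (Real.sqrt_le_left hB0).1 (sqrt_sum_sq_fourierCoeff_le hf hfL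
      (n := fun k => Λ (r + q * k)) (sum_range_lt_of_two_mul_le ?_ fun k => ?_) N)
    · exact hpos.trans_le (hΛ.monotone (Nat.zero_le _))
    · simpa [mul_add, add_assoc] using two_mul_le_of_sigmaT hΛ hpos hbdd (r + q * k)
  have hpartial (N : ℕ) :
      ∑ j ∈ Finset.range N, ‖fourierCoeff f (Λ j : ℤ)‖ ^ 2 ≤ q * B ^ 2 := by
    calc _ ≤ ∑ j ∈ Finset.range (q * N), ‖fourierCoeff f (Λ j : ℤ)‖ ^ 2 :=
          Finset.sum_le_sum_of_subset_of_nonneg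
            (Finset.range_mono (Nat.le_mul_of_pos_left N (by omega)))
            fun _ _ _ => by positivity
      _ ≤ ∑ r ∈ Finset.range q, B ^ 2 := by
          rw [sum_range_mul_eq_sum_sum]
          exact Finset.sum_le_sum fun r _ => hclass r N
      _ = q * B ^ 2 := by simp
  calc Real.sqrt (∑' j : ℕ, ‖fourierCoeff f (Λ j : ℤ)‖ ^ 2)
      ≤ Real.sqrt (q * B ^ 2) := Real.sqrt_le_sqrt
        (Real.tsum_le_of_sum_range_le (fun _ => by positivity) hpartial)
    _ = Real.sqrt 2 * Real.sqrt (sigmaT Λ) * B := by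
        rw [Real.sqrt_mul (Nat.cast_nonneg _), Real.sqrt_sq hB0, hq, Nat.cast_mul,
          Real.sqrt_mul (Nat.cast_nonneg _), Nat.cast_ofNat]
    _ ≤ Real.sqrt 2 * Real.sqrt (sigmaT Λ) * ((16 + 32 * gaussConst) * (1 + J)) := by
        gcongr
        nlinarith
    _ = _ := by ring

end
end
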